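/- Let A be a k-algebra with center Z. If Z/N(Z) is a von Neumann regular commutative algebra (i.e., a reduced commutative algebra of Krull dimension zero), then A is strongly cancellative and strongly Morita cancellative. -/

import Mathlib

open scoped TensorProduct

universe u

/-- The polynomial extension `A[t₁,…,tₙ]` of a (possibly noncommutative) `k`-algebra `A`
in `n` central, mutually commuting indeterminates. -/
abbrev PolyExt (A : Type u) [Ring A] (n : ℕ) : Type u :=
  AddMonoidAlgebra A (Fin n →₀ ℕ)

/-- The canonical embedding `A → A[t₁,…,tₙ]` as constant polynomials. -/
noncomputable def PolyExt.C (k A : Type u) [Field k] [Ring A] [Algebra k A] (n : ℕ) :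
    A →ₐ[k] PolyExt A n :=
  AddMonoidAlgebra.singleZeroAlgHom

/-- The `i`-th indeterminate of `A[t₁,…,tₙ]`. -/
noncomputable def PolyExt.X (A : Type u) [Ring A] (n : ℕ) (i : Fin n) : PolyExt A n :=
  AddMonoidAlgebra.single (Finsupp.single i 1) 1

/-- Two rings are Morita equivalent if their categories of right modules are
equivalent (as abelian categories). -/
def MoritaEquivalent (R S : Type u) [Ring R] [Ring S] : Prop :=
  Nonempty (ModuleCat.{u} Rᵐᵒᵖ ≌ ModuleCat.{u} Sᵐᵒᵖ)

/-- `A` is strongly cancellative: for every `n ≥ 1` and every `k`-algebra `B`, any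
`k`-algebra isomorphism `A[s₁,…,sₙ] ≅ B[t₁,…,tₙ]` implies `A ≅ B`. -/
def StronglyCancellative (k A : Type u) [Field k] [Ring A] [Algebra k A] : Prop :=
  ∀ (n : ℕ), 1 ≤ n → ∀ (B : Type u) [Ring B] [Algebra k B],
    Nonempty (PolyExt A n ≃ₐ[k] PolyExt B n) → Nonempty (A ≃ₐ[k] B)

/-- `A` is strongly Morita cancellative: for every `n ≥ 1` and every `k`-algebra `B`,
Morita equivalence of `A[s₁,…,sₙ]` and `B[t₁,…,tₙ]` implies Morita equivalence of `A` and `B`. -/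
def StronglyMoritaCancellative (k A : Type u) [Field k] [Ring A] [Algebra k A] : Prop :=
  ∀ (n : ℕ), 1 ≤ n → ∀ (B : Type u) [Ring B] [Algebra k B],
    MoritaEquivalent (PolyExt A n) (PolyExt B n) → MoritaEquivalent A B

/-- `A` is strongly retractable: every `k`-algebra isomorphism
`φ : A[s₁,…,sₙ] → B[t₁,…,tₙ]` (with `n ≥ 1`) satisfies `φ(A) = B`. -/
def StronglyRetractable (k A : Type u) [Field k] [Ring A] [Algebra k A] : Prop :=
  ∀ (n : ℕ), 1 ≤ n → ∀ (B : Type u) [Ring B] [Algebra k B]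
    (φ : PolyExt A n ≃ₐ[k] PolyExt B n),
    φ '' Set.range (PolyExt.C k A n) = Set.range (PolyExt.C k B n)

/-- `A` is strongly detectable: for every `k`-algebra isomorphism
`φ : A[s₁,…,sₙ] → B[t₁,…,tₙ]` (with `n ≥ 1`), the subalgebra of `B[t₁,…,tₙ]` generated by
`B` together with `φ(s₁),…,φ(sₙ)` is all of `B[t₁,…,tₙ]`. -/
def StronglyDetectable (k A : Type u) [Field k] [Ring A] [Algebra k A] : Prop :=
  ∀ (n : ℕ), 1 ≤ n → ∀ (B : Type u) [Ring B] [Algebra k B]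
    (φ : PolyExt A n ≃ₐ[k] PolyExt B n),
    Algebra.adjoin k
      (Set.range (PolyExt.C k B n) ∪ Set.range fun i => φ (PolyExt.X A n i)) = ⊤

theorem RingHom.injective_of_surjective_of_isNoetherianRing {R : Type*} [CommRing R]
    [IsNoetherianRing R] (f : R →+* R) (hf : Function.Surjective f) : Function.Injective f := by
  have hsurj : ∀ n : ℕ, Function.Surjective (f ^ n) := fun n => by
    rw [RingHom.coe_pow]; exact hf.iterate n
  let K : ℕ →o Ideal R :=
    ⟨fun n => RingHom.ker (f ^ n), monotone_nat_of_le_succ fun n x hx => by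
      rw [RingHom.mem_ker] at hx ⊢
      rw [pow_succ', RingHom.mul_def, RingHom.comp_apply, hx, map_zero]⟩
  obtain ⟨n, hn⟩ := monotone_stabilizes_iff_noetherian.mpr ‹IsNoetherianRing R› K
  rw [injective_iff_map_eq_zero]
  intro x hx
  obtain ⟨y, rfl⟩ := hsurj n x
  have : y ∈ K (n + 1) := by
    change (f ^ (n + 1)) y = 0
    rwa [pow_succ', RingHom.mul_def, RingHom.comp_apply]
  rw [← hn (n + 1) n.le_succ] at this
  exact this

namespace MvPolynomial

variable {σ : Type*}

theorem aeval_injective_of_surjective [Finite σ] {Y : Type*} [CommRing Y] (f : σ → MvPolynomial σ Y)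
    (hf : Function.Surjective (aeval f : MvPolynomial σ Y →ₐ[Y] MvPolynomial σ Y)) :
    Function.Injective (aeval f : MvPolynomial σ Y →ₐ[Y] MvPolynomial σ Y) := by
  classical
  cases nonempty_fintype σ
  choose g hg using fun i => hf (X i)
  rw [injective_iff_map_eq_zero]
  intro p hp
  let s : Finset Y := p.coeffs ∪ Finset.univ.biUnion (fun i => (f i).coeffs ∪ (g i).coeffs)
  let Y₀ := Algebra.adjoin ℤ (s : Set Y)
  have : IsNoetherianRing Y₀ := isNoetherianRing_of_fg (Subalgebra.fg_adjoin_finset s)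
  let ι : Y₀ →+* Y := Y₀.val
  have hι : Function.Injective (map (σ := σ) ι) := map_injective _ Subtype.val_injective
  have hlift : ∀ q : MvPolynomial σ Y, q.coeffs ⊆ s → ∃ q₀, map ι q₀ = q := by
    intro q hq
    refine mem_range_map_iff_coeffs_subset.mpr fun c hc => ?_
    exact ⟨⟨c, Algebra.subset_adjoin (hq hc)⟩, rfl⟩
  obtain ⟨p₀, hp₀⟩ := hlift p Finset.subset_union_left
  choose f₀ hf₀ using fun i => hlift (f i) (fun c hc => Finset.mem_union_right _
    (Finset.mem_biUnion.mpr ⟨i, Finset.mem_univ i, Finset.mem_union_left _ hc⟩))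
  choose g₀ hg₀ using fun i => hlift (g i) (fun c hc => Finset.mem_union_right _
    (Finset.mem_biUnion.mpr ⟨i, Finset.mem_univ i, Finset.mem_union_right _ hc⟩))
  let α₀ : MvPolynomial σ Y₀ →ₐ[Y₀] MvPolynomial σ Y₀ := aeval f₀
  have hcomm : ∀ q, map ι (α₀ q) = aeval f (map ι q) := by
    intro q
    have : (map ι).comp α₀.toRingHom = (aeval f).toRingHom.comp (map ι) := by
      ext i <;> simp [α₀, hf₀]
    exact DFunLike.congr_fun this q
  have hsurj : Function.Surjective α₀ := by
    rw [← AlgHom.range_eq_top, ← top_le_iff, ← adjoin_range_X, Algebra.adjoin_le_iff]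
    rintro _ ⟨i, rfl⟩
    refine ⟨g₀ i, hι ?_⟩
    rw [map_X, ← hg i, ← hg₀ i]
    exact hcomm (g₀ i)
  have hinj := RingHom.injective_of_surjective_of_isNoetherianRing α₀.toRingHom hsurj
  have : α₀.toRingHom p₀ = 0 := hι (by
    rw [map_zero]
    exact (hcomm p₀).trans (by rw [hp₀, hp]))
  rw [← hp₀, (injective_iff_map_eq_zero _).mp hinj p₀ this, map_zero]

/-- An endomorphism of a polynomial ring that is the identity modulo a nilpotent ideal of the
coefficient ring is bijective. -/
theorem aeval_bijective_of_sub_X_mem {Y : Type*} [CommRing Y] {I : Ideal Y} (hI : IsNilpotent I)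
    (h : σ → MvPolynomial σ Y) (hX : ∀ i, h i - X i ∈ I.map C) :
    Function.Bijective (aeval h : MvPolynomial σ Y →ₐ[Y] MvPolynomial σ Y) := by
  have hid : ∀ q, aeval h q - q ∈ I.map (C (σ := σ)) := by
    intro q
    rw [← Ideal.Quotient.mk_eq_mk_iff_sub_mem]
    have : (Ideal.Quotient.mkₐ Y (I.map (C (σ := σ)))).comp (aeval h) =
        Ideal.Quotient.mkₐ Y _ := by
      ext i
      simpa [Ideal.Quotient.mk_eq_mk_iff_sub_mem] using hX i
    exact DFunLike.congr_fun this q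
  let E : Module.End Y (MvPolynomial σ Y) := (aeval h).toLinearMap
  have hrange : ∀ n q, ((E - 1) ^ n) q ∈ (I ^ n).map (C (σ := σ)) := by
    have hstep : ∀ n, ∀ q ∈ (I ^ n).map (C (σ := σ)), ∀ a,
        (E - 1) (a * q) ∈ (I ^ (n + 1)).map (C (σ := σ)) := by
      intro n q hq
      induction hq using Submodule.span_induction with
      | mem x hx =>
        obtain ⟨c, hc, rfl⟩ := hx
        intro a
        rw [mul_comm, ← smul_eq_C_mul, map_smul, smul_eq_C_mul, pow_succ, Ideal.map_mul]
        exact Ideal.mul_mem_mul (Ideal.mem_map_of_mem C hc) (hid a)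
      | zero => simp
      | add x y _ _ hx hy => intro a; rw [mul_add, map_add]; exact add_mem (hx a) (hy a)
      | smul b x _ hx => intro a; rw [smul_eq_mul, ← mul_assoc]; exact hx (a * b)
    intro n
    induction n with
    | zero => simp [Ideal.one_eq_top, Ideal.map_top]
    | succ n ih =>
      intro q
      rw [pow_succ' (E - 1)]
      simpa using hstep n _ (ih q) 1
  obtain ⟨n, hn⟩ := hI
  have hnil : IsNilpotent (E - 1) := ⟨n, LinearMap.ext fun q => by
    simpa [hn] using hrange n q⟩
  have := hnil.isUnit_add_one
  rw [sub_add_cancel] at this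
  exact (Module.End.isUnit_iff _).mp this


/-- A ring homomorphism from a zero-dimensional ring to a polynomial ring takes values in the
constants up to nilpotent coefficients. -/
theorem isNilpotent_coeff_of_krullDimLE_zero {Z Y : Type*} [CommRing Z] [CommRing Y]
    [Ring.KrullDimLE 0 Z] (φ : Z →+* MvPolynomial σ Y) (z : Z) {m : σ →₀ ℕ} (hm : m ≠ 0) :
    IsNilpotent (coeff m (φ z)) := by
  classical
  rw [← mem_nilradical, nilradical_eq_sInf, Ideal.mem_sInf]
  intro q hq
  have : q.IsPrime := hq
  let ψ : Z →+* MvPolynomial σ (Y ⧸ q) := (map (Ideal.Quotient.mk q)).comp φ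
  have hconst : coeff m (ψ z) = 0 := by
    by_cases hz : z ∈ RingHom.ker ψ
    · rw [RingHom.mem_ker.mp hz, coeff_zero]
    · have hmax : (RingHom.ker ψ).IsMaximal := (RingHom.ker_isPrime ψ).isMaximal'
      obtain ⟨y, i, hi, hy⟩ := hmax.exists_inv hz
      have hunit : IsUnit (ψ z) := IsUnit.of_mul_eq_one (ψ y) (by
        have := congrArg ψ hy
        rw [map_add, map_mul, RingHom.mem_ker.mp hi, add_zero, map_one] at this
        rw [mul_comm, this])
      obtain ⟨r, -, hr⟩ := isUnit_iff_eq_C_of_isReduced.mp hunit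
      rw [hr, coeff_C, if_neg hm.symm]
  rw [← Ideal.Quotient.eq_zero_iff_mem, ← hconst]
  simp [ψ, coeff_map]

/-- The images of the variables under an isomorphism `Z[σ] ≃ Y[σ]` are free polynomial generators
of `Y[σ]` over `Y` if `Z` is zero-dimensional. -/
theorem aeval_bijective_of_krullDimLE_zero [Finite σ] {Z Y : Type*} [CommRing Z] [CommRing Y]
    [Ring.KrullDimLE 0 Z] (θ : MvPolynomial σ Z ≃+* MvPolynomial σ Y) :
    Function.Bijective
      (aeval (fun i => θ (X i)) : MvPolynomial σ Y →ₐ[Y] MvPolynomial σ Y) := by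
  classical
  cases nonempty_fintype σ
  set α : MvPolynomial σ Y →ₐ[Y] MvPolynomial σ Y := aeval (fun i => θ (X i)) with hα
  have hmod : ∀ q, ∃ p, ∀ m, IsNilpotent (coeff m (α p - q)) := by
    let π := map (σ := σ) (Ideal.Quotient.mk (nilradical Y))
    have key : ∀ r, π (θ r) ∈ (π.comp α.toRingHom).range := by
      intro r
      induction r using MvPolynomial.induction_on with
      | C z =>
        refine ⟨C (coeff 0 (θ (C z))), ?_⟩
        ext m
        rcases eq_or_ne m 0 with rfl | hm
        · simp [π, coeff_map]
        · have := isNilpotent_coeff_of_krullDimLE_zero (θ.toRingHom.comp C) z hm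
          rw [← mem_nilradical, ← Ideal.Quotient.eq_zero_iff_mem] at this
          simpa [π, coeff_map, coeff_C, hm.symm] using this.symm
      | add p q hp hq => rw [map_add, map_add]; exact add_mem hp hq
      | mul_X p i hp =>
        rw [map_mul, map_mul]
        exact mul_mem hp ⟨X i, by simp [hα]⟩
    intro q
    obtain ⟨p, hp⟩ := key (θ.symm q)
    refine ⟨p, fun m => ?_⟩
    rw [← mem_nilradical, ← Ideal.Quotient.eq_zero_iff_mem, ← coeff_map, map_sub, coeff_sub,
      sub_eq_zero]
    rw [θ.apply_symm_apply] at hp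
    exact congrArg (coeff m) hp
  choose p hp using fun i => hmod (X i)
  have hsurj : Function.Surjective α := by
    let s : Finset Y := Finset.univ.biUnion fun i => (α (p i) - X i).coeffs
    have hI : IsNilpotent (Ideal.span (s : Set Y)) := by
      refine (Ideal.FG.isNilpotent_iff_le_nilradical ⟨s, rfl⟩).mpr (Ideal.span_le.mpr ?_)
      intro c hc
      obtain ⟨i, -, hi⟩ := Finset.mem_biUnion.mp hc
      obtain ⟨m, -, rfl⟩ := mem_coeffs_iff.mp hi
      exact hp i m
    have hbij := aeval_bijective_of_sub_X_mem hI (fun i => α (p i)) fun i => by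
      rw [mem_map_C_iff]
      intro m
      by_cases hm : coeff m (α (p i) - X i) = 0
      · rw [hm]; exact zero_mem _
      · exact Ideal.subset_span (Finset.mem_biUnion.mpr
          ⟨i, Finset.mem_univ i, coeff_mem_coeffs m hm⟩)
    have hcomp : (aeval fun i => α (p i) : MvPolynomial σ Y →ₐ[Y] MvPolynomial σ Y) =
        α.comp (aeval p) := by
      ext i; simp
    rw [hcomp, AlgHom.coe_comp] at hbij
    exact hbij.surjective.of_comp
  exact ⟨aeval_injective_of_surjective _ hsurj, hsurj⟩

end MvPolynomial

namespace PolyExt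

variable {A : Type u} [Ring A] {n : ℕ}

/-- The embedding of constants, as a ring homomorphism. -/
noncomputable def const (A : Type u) [Ring A] (n : ℕ) : A →+* PolyExt A n :=
  AddMonoidAlgebra.singleZeroRingHom

theorem const_apply (a : A) : const A n a = AddMonoidAlgebra.single 0 a := rfl

theorem single_mul_X (m : Fin n →₀ ℕ) (a : A) (i : Fin n) :
    AddMonoidAlgebra.single m a * X A n i = AddMonoidAlgebra.single (m + Finsupp.single i 1) a := by
  rw [X, AddMonoidAlgebra.single_mul_single, mul_one]

@[elab_as_elim]
theorem induction_on {motive : PolyExt A n → Prop} (p : PolyExt A n)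
    (const : ∀ a, motive (const A n a)) (add : ∀ p q, motive p → motive q → motive (p + q))
    (mul_X : ∀ p i, motive p → motive (p * X A n i)) : motive p := by
  have hmono : ∀ (m : Fin n →₀ ℕ) (a : A), motive (AddMonoidAlgebra.single m a) := by
    intro m a
    induction m using Finsupp.induction with
    | zero => exact const a
    | single_add i b f _ _ ih =>
      clear * - ih mul_X
      induction b with
      | zero => simpa using ih
      | succ b hb =>
        rw [Finsupp.single_add, add_right_comm, ← single_mul_X]
        exact mul_X _ i hb
  induction p using AddMonoidAlgebra.induction_linear with
  | zero => simpa using const 0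
  | add p q hp hq => exact add p q hp hq
  | single m a => exact hmono m a

theorem ringHom_ext {R : Type*} [Semiring R] {f g : PolyExt A n →+* R}
    (hconst : ∀ a, f (const A n a) = g (const A n a)) (hX : ∀ i, f (X A n i) = g (X A n i)) :
    f = g := by
  refine RingHom.ext fun p => ?_
  induction p using induction_on with
  | const a => exact hconst a
  | add p q hp hq => rw [map_add, map_add, hp, hq]
  | mul_X p i hp => rw [map_mul, map_mul, hp, hX]

theorem commute_X (p : PolyExt A n) (i : Fin n) : Commute (X A n i) p := by
  induction p using AddMonoidAlgebra.induction_linear with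
  | zero => exact Commute.zero_right _
  | add p q hp hq => exact hp.add_right hq
  | single m a =>
    rw [Commute, SemiconjBy, single_mul_X, X, AddMonoidAlgebra.single_mul_single, one_mul, add_comm]

/-- The ring homomorphism out of `A[t₁,…,tₙ]` with prescribed values on constants and prescribed
central values on the indeterminates. -/
noncomputable def lift {R : Type*} [Ring R] (f : A →+* R) (x : Fin n → Subring.center R) :
    PolyExt A n →+* R :=
  AddMonoidAlgebra.liftNCRingHom f
    ((Subring.center R).subtype.toMonoidHom.comp
      { toFun := fun m => m.toAdd.prod fun i e => x i ^ e
        map_one' := Finsupp.prod_zero_index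
        map_mul' := fun _ _ => Finsupp.prod_add_index' (by simp) (by simp [pow_add]) })
    fun a _ => (Subring.mem_center_iff.mp (Subtype.property _) (f a))

@[simp]
theorem lift_const {R : Type*} [Ring R] (f : A →+* R) (x : Fin n → Subring.center R) (a : A) :
    lift f x (const A n a) = f a := by
  simp [lift, const_apply]

@[simp]
theorem lift_X {R : Type*} [Ring R] (f : A →+* R) (x : Fin n → Subring.center R) (i : Fin n) :
    lift f x (X A n i) = x i := by
  simp [lift, X, Finsupp.single_apply, pow_ite]

/-- Evaluation at the origin. -/
noncomputable def evalZero (A : Type u) [Ring A] (n : ℕ) : PolyExt A n →+* A :=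
  lift (RingHom.id A) 0

@[simp]
theorem evalZero_const (a : A) : evalZero A n (const A n a) = a := by simp [evalZero]

@[simp]
theorem evalZero_X (i : Fin n) : evalZero A n (X A n i) = 0 := by simp [evalZero]

/-- The ideal of polynomials vanishing at the origin is generated by the indeterminates. -/
theorem exists_eq_sum_of_evalZero_eq_zero {p : PolyExt A n} (hp : evalZero A n p = 0) :
    ∃ a : Fin n → PolyExt A n, p = ∑ i, a i * X A n i := by
  have key : ∀ p : PolyExt A n,
      p - const A n (evalZero A n p) ∈ Submodule.span (PolyExt A n) (Set.range (X A n)) := by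
    intro p
    induction p using induction_on with
    | const a => simp
    | add p q hp hq =>
      rw [map_add, map_add, add_sub_add_comm]
      exact add_mem hp hq
    | mul_X p i _ =>
      rw [map_mul, evalZero_X, mul_zero, map_zero, sub_zero]
      exact Submodule.smul_mem _ p (Submodule.subset_span ⟨i, rfl⟩)
  have := key p
  rw [hp, map_zero, sub_zero, Submodule.mem_span_range_iff_exists_fun] at this
  obtain ⟨a, ha⟩ := this
  exact ⟨a, ha.symm⟩

/-- An isomorphism `B[t₁,…,tₙ] ≃ A[t₁,…,tₙ]` preserving the indeterminates induces an isomorphism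
of the coefficient rings. -/
theorem bijective_evalZero_comp_const {B : Type u} [Ring B] (χ : PolyExt B n ≃+* PolyExt A n)
    (hχ : ∀ i, χ (X B n i) = X A n i) :
    Function.Bijective fun b => evalZero A n (χ (const B n b)) := by
  have key : ∀ {A B : Type u} [Ring A] [Ring B] (χ : PolyExt B n ≃+* PolyExt A n)
      (_ : ∀ i, χ (X B n i) = X A n i) (p : PolyExt B n),
      evalZero A n (χ (const B n (evalZero B n p))) = evalZero A n (χ p) := by
    intro A B _ _ χ hχ p
    have : (((evalZero A n).comp χ.toRingHom).comp (const B n)).comp (evalZero B n) =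
        (evalZero A n).comp χ.toRingHom :=
      ringHom_ext (by simp) (by simp [hχ])
    exact DFunLike.congr_fun this p
  have hχ' : ∀ i, χ.symm (X A n i) = X B n i := fun i => by rw [← hχ, χ.symm_apply_apply]
  refine Function.bijective_iff_has_inverse.mpr
    ⟨fun a => evalZero B n (χ.symm (const A n a)), fun b => ?_, fun a => ?_⟩
  · simp [key χ.symm hχ']
  · simp [key χ hχ]

/-- The inclusion of `Z(A)[t₁,…,tₙ]` into `A[t₁,…,tₙ]`. -/
noncomputable def ofCenter (A : Type u) [Ring A] (n : ℕ) :
    MvPolynomial (Fin n) (Subring.center A) →+* PolyExt A n :=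
  AddMonoidAlgebra.mapRingHom (Fin n →₀ ℕ) (Subring.center A).subtype

theorem coeff_ofCenter (p : MvPolynomial (Fin n) (Subring.center A)) (m : Fin n →₀ ℕ) :
    (ofCenter A n p).coeff m = p.coeff m :=
  AddMonoidAlgebra.coeff_mapRingHom _ _ _

@[simp]
theorem ofCenter_C (z : Subring.center A) : ofCenter A n (MvPolynomial.C z) = const A n z :=
  AddMonoidAlgebra.mapRingHom_single _ _ _

@[simp]
theorem ofCenter_X (i : Fin n) : ofCenter A n (MvPolynomial.X i) = X A n i :=
  AddMonoidAlgebra.mapRingHom_single _ _ _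

theorem ofCenter_injective : Function.Injective (ofCenter A n) := by
  intro p q h
  ext m
  rw [← coeff_ofCenter, h, coeff_ofCenter]

theorem ofCenter_mem_center (p : MvPolynomial (Fin n) (Subring.center A)) :
    ofCenter A n p ∈ Subring.center (PolyExt A n) := by
  induction p using MvPolynomial.induction_on with
  | C z =>
    rw [ofCenter_C, Subring.mem_center_iff]
    intro q
    induction q using AddMonoidAlgebra.induction_linear with
    | zero => simp
    | add p q hp hq => rw [add_mul, mul_add, hp, hq]
    | single m a =>
      simp only [const_apply, AddMonoidAlgebra.single_mul_single, add_zero, zero_add]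
      rw [Subring.mem_center_iff.mp z.2 a]
  | add p q hp hq => rw [map_add]; exact add_mem hp hq
  | mul_X p i hp =>
    rw [map_mul, ofCenter_X]
    exact mul_mem hp (Subring.mem_center_iff.mpr fun q => (commute_X q i).symm)

theorem coeff_mem_center {p : PolyExt A n} (hp : p ∈ Subring.center (PolyExt A n))
    (m : Fin n →₀ ℕ) : p.coeff m ∈ Subring.center A := by
  rw [Subring.mem_center_iff] at hp ⊢
  intro a
  have := congrArg (fun q => q.coeff m) (hp (const A n a))
  simpa [const_apply, AddMonoidAlgebra.coeff_single_zero_mul,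
    AddMonoidAlgebra.coeff_mul_single_zero] using this

theorem exists_ofCenter_eq {p : PolyExt A n} (hp : p ∈ Subring.center (PolyExt A n)) :
    ∃ q, ofCenter A n q = p := by
  refine ⟨AddMonoidAlgebra.ofCoeff (Finsupp.onFinset p.coeff.support
    (fun m => ⟨p.coeff m, coeff_mem_center hp m⟩) fun m hm => ?_), ?_⟩
  · exact Finsupp.mem_support_iff.mpr fun h => hm (Subtype.ext h)
  · ext m
    rw [coeff_ofCenter]
    rfl

/-- The center of `A[t₁,…,tₙ]` is `Z(A)[t₁,…,tₙ]`. -/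
noncomputable def centerEquiv (A : Type u) [Ring A] (n : ℕ) :
    MvPolynomial (Fin n) (Subring.center A) ≃+* Subring.center (PolyExt A n) :=
  RingEquiv.ofBijective ((ofCenter A n).codRestrict _ ofCenter_mem_center)
    ⟨fun _ _ h => ofCenter_injective (congrArg Subtype.val h), fun p =>
      (exists_ofCenter_eq p.2).imp fun _ h => Subtype.ext h⟩

@[simp]
theorem coe_centerEquiv (p : MvPolynomial (Fin n) (Subring.center A)) :
    (centerEquiv A n p : PolyExt A n) = ofCenter A n p := rfl

/-- The endomorphism of `A[t₁,…,tₙ]` fixing `A` and sending the indeterminates to given central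
polynomials. -/
noncomputable def centralSubst (f : Fin n → MvPolynomial (Fin n) (Subring.center A)) :
    PolyExt A n →+* PolyExt A n :=
  lift (const A n) fun i => centerEquiv A n (f i)

theorem centralSubst_ofCenter (f : Fin n → MvPolynomial (Fin n) (Subring.center A))
    (p : MvPolynomial (Fin n) (Subring.center A)) :
    centralSubst f (ofCenter A n p) = ofCenter A n (MvPolynomial.aeval f p) := by
  have : (centralSubst f).comp (ofCenter A n) =
      (ofCenter A n).comp (MvPolynomial.aeval f).toRingHom := by
    apply MvPolynomial.ringHom_ext <;> simp [centralSubst]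
  exact DFunLike.congr_fun this p

theorem centralSubst_leftInverse {f g : Fin n → MvPolynomial (Fin n) (Subring.center A)}
    (h : ∀ i, MvPolynomial.aeval f (g i) = MvPolynomial.X i) :
    Function.LeftInverse (centralSubst f) (centralSubst g) := by
  have : (centralSubst f).comp (centralSubst g) = RingHom.id (PolyExt A n) := by
    refine ringHom_ext (by simp [centralSubst]) fun i => ?_
    rw [RingHom.comp_apply]
    nth_rw 2 [centralSubst]
    rw [lift_X, coe_centerEquiv, centralSubst_ofCenter, h, ofCenter_X, RingHom.id_apply]
  exact DFunLike.congr_fun this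

theorem centralSubst_bijective {f : Fin n → MvPolynomial (Fin n) (Subring.center A)}
    (hf : Function.Bijective (MvPolynomial.aeval f : MvPolynomial (Fin n) (Subring.center A) →ₐ[
      Subring.center A] MvPolynomial (Fin n) (Subring.center A))) :
    Function.Bijective (centralSubst f) := by
  choose g hg using fun i => hf.surjective (MvPolynomial.X i)
  have hg' : ∀ i, MvPolynomial.aeval g (f i) = MvPolynomial.X i := by
    have : (MvPolynomial.aeval f).comp (MvPolynomial.aeval g) =
        AlgHom.id (Subring.center A) (MvPolynomial (Fin n) (Subring.center A)) :=
      MvPolynomial.algHom_ext fun i => by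
        simp only [AlgHom.comp_apply, MvPolynomial.aeval_X, hg, AlgHom.id_apply]
    intro i
    apply hf.injective
    rw [← AlgHom.comp_apply, this, AlgHom.id_apply, MvPolynomial.aeval_X]
  exact ⟨(centralSubst_leftInverse hg').injective, (centralSubst_leftInverse hg).surjective⟩

/-- If `Z(A)` is zero-dimensional and the centers of `A[s₁,…,sₙ]` and `B[t₁,…,tₙ]` are isomorphic,
then `B[t₁,…,tₙ]` is also a polynomial extension of `B` in the images of the `sᵢ`. -/
theorem exists_ringEquiv_of_center {B : Type u} [Ring B] [Ring.KrullDimLE 0 (Subring.center A)]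
    (θ : Subring.center (PolyExt A n) ≃+* Subring.center (PolyExt B n)) :
    ∃ Φ : PolyExt B n ≃+* PolyExt B n, (∀ b, Φ (const B n b) = const B n b) ∧
      ∀ i, Φ (X B n i) = θ (centerEquiv A n (MvPolynomial.X i)) := by
  let θ' := ((centerEquiv A n).trans θ).trans (centerEquiv B n).symm
  refine ⟨RingEquiv.ofBijective _
    (centralSubst_bijective (MvPolynomial.aeval_bijective_of_krullDimLE_zero θ')), fun b => ?_,
    fun i => ?_⟩
  · simp [centralSubst]
  · simp [centralSubst, θ']

end PolyExt

namespace ModuleCat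

open CategoryTheory

variable {R S : Type u} [Ring R] [Ring S]

/-- Multiplication by a central element, as an endomorphism of a module. -/
def centralSMul (z : Subring.center R) (M : ModuleCat.{u} R) : M ⟶ M :=
  ofHom
    { toFun := fun m => (z : R) • m
      map_add' := smul_add _
      map_smul' := fun r m => by
        rw [RingHom.id_apply, smul_smul, smul_smul, Subring.mem_center_iff.mp z.2 r] }

@[simp]
theorem centralSMul_apply (z : Subring.center R) (M : ModuleCat.{u} R) (m : M) :
    centralSMul z M m = (z : R) • m := rfl

theorem centralSMul_naturality (z : Subring.center R) {M N : ModuleCat.{u} R} (f : M ⟶ N) :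
    centralSMul z M ≫ f = f ≫ centralSMul z N := by
  ext m
  simp

/-- Every endomorphism of the identity functor of a module category is multiplication by a central
element. -/
theorem exists_eq_centralSMul (φ : 𝟭 (ModuleCat.{u} R) ⟶ 𝟭 (ModuleCat.{u} R)) :
    ∃ z : Subring.center R, ∀ M, φ.app M = centralSMul z M := by
  let c : R := (φ.app (of R R)).hom (1 : R)
  have key : ∀ (M : ModuleCat.{u} R) (m : M), (φ.app M).hom m = c • m := fun M m => by
    have h := CategoryTheory.congr_fun
      (φ.naturality (ofHom (LinearMap.toSpanSingleton R M m))) (1 : R)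
    have h1 : (φ.app M).hom ((1 : R) • m) = c • m := h
    rwa [one_smul] at h1
  refine ⟨⟨c, Subring.mem_center_iff.mpr fun r => ?_⟩, fun M => ?_⟩
  · have h1 : (φ.app (of R R)).hom (r • (1 : R)) = r • c :=
      (φ.app (of R R)).hom.map_smul r (1 : R)
    have h2 := key (of R R) (r • (1 : R))
    rw [h1] at h2
    simpa using h2
  · ext m
    exact key M m

theorem centralSMul_injective {z w : Subring.center R}
    (h : ∀ M : ModuleCat.{u} R, centralSMul z M = centralSMul w M) : z = w := by
  have h1 : (z : R) • (1 : R) = (w : R) • (1 : R) :=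
    CategoryTheory.congr_fun (h (of R R)) (1 : R)
  exact Subtype.ext (by simpa using h1)

theorem centralSMul_one (M : ModuleCat.{u} R) : centralSMul 1 M = 𝟙 M := by
  ext m; simp

theorem centralSMul_mul (z w : Subring.center R) (M : ModuleCat.{u} R) :
    centralSMul (z * w) M = centralSMul w M ≫ centralSMul z M := by
  ext m
  exact mul_smul (z : R) (w : R) m

theorem centralSMul_add (z w : Subring.center R) (M : ModuleCat.{u} R) :
    centralSMul (z + w) M = centralSMul z M + centralSMul w M := by
  ext m; simp [add_smul]

/-- An equivalence of module categories induces an isomorphism of centers compatible with the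
action on modules. -/
theorem exists_center_ringEquiv (E : ModuleCat.{u} R ≌ ModuleCat.{u} S) :
    ∃ σ : Subring.center R ≃+* Subring.center S, ∀ z M,
      E.functor.map (centralSMul z M) = centralSMul (σ z) (E.functor.obj M) := by
  have : E.functor.Additive := Functor.additive_of_preserves_binary_products _
  have hex : ∀ z : Subring.center R, ∃ w : Subring.center S, ∀ M,
      E.functor.map (centralSMul z M) = centralSMul w (E.functor.obj M) := by
    intro z
    let φ : 𝟭 (ModuleCat.{u} S) ⟶ 𝟭 (ModuleCat.{u} S) :=
      { app := fun N => E.counitInv.app N ≫ E.functor.map (centralSMul z (E.inverse.obj N)) ≫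
          E.counit.app N
        naturality := fun N N' f => by
          have h := congrArg E.functor.map (centralSMul_naturality z (E.inverse.map f))
          replace h := congrArg (· ≫ E.counit.app N') h
          simp only [Functor.map_comp, Category.assoc] at h
          simp only [Functor.id_obj, Functor.id_map, Category.assoc]
          rw [← E.counit_naturality f, h, E.counitInv_naturality_assoc] }
    obtain ⟨w, hw⟩ := exists_eq_centralSMul φ
    refine ⟨w, fun M => ?_⟩
    rw [← hw]
    have h := congrArg E.functor.map (centralSMul_naturality z (E.unit.app M))
    replace h := congrArg (· ≫ E.counit.app (E.functor.obj M)) h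
    simp only [Functor.map_comp, Category.assoc] at h
    simp only [φ, Equivalence.counitInv_app_functor]
    erw [← h]
    simp
  choose σ hσ using hex
  have hinj : ∀ {w w' : Subring.center S}, (∀ M : ModuleCat.{u} R,
      centralSMul w (E.functor.obj M) = centralSMul w' (E.functor.obj M)) → w = w' := by
    intro w w' h
    refine centralSMul_injective fun N => ?_
    have h1 := h (E.inverse.obj N)
    have h2 := centralSMul_naturality w (E.counit.app N)
    have h3 := centralSMul_naturality w' (E.counit.app N)
    refine (cancel_epi (E.counit.app N)).mp (h2.symm.trans (Eq.trans ?_ h3))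
    exact congrArg (· ≫ E.counit.app N) h1
  let F : Subring.center R →+* Subring.center S :=
    { toFun := σ
      map_one' := hinj fun M => by
        rw [← hσ, centralSMul_one, centralSMul_one, CategoryTheory.Functor.map_id]
      map_mul' := fun z w => hinj fun M => by
        rw [← hσ, centralSMul_mul, centralSMul_mul, Functor.map_comp, hσ, hσ]
      map_zero' := hinj fun M => by
        have h0 : ∀ {R : Type u} [Ring R] (M : ModuleCat.{u} R), centralSMul 0 M = 0 := by
          intro R _ M; ext m; simp
        rw [← hσ, h0, h0, Functor.map_zero]
      map_add' := fun z w => hinj fun M => by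
        rw [← hσ, centralSMul_add, centralSMul_add, Functor.map_add, hσ, hσ] }
  refine ⟨RingEquiv.ofBijective F ⟨fun z w h => ?_, fun w => ?_⟩, hσ⟩
  · refine centralSMul_injective fun M => E.functor.map_injective ?_
    rw [hσ, hσ]
    exact congrArg (fun w => centralSMul w _) h
  · let φ : 𝟭 (ModuleCat.{u} R) ⟶ 𝟭 (ModuleCat.{u} R) :=
      { app := fun M => E.functor.preimage (centralSMul w (E.functor.obj M))
        naturality := fun M M' f => E.functor.map_injective (by
          simp [centralSMul_naturality]) }
    obtain ⟨z, hz⟩ := exists_eq_centralSMul φ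
    refine ⟨z, hinj fun M => ?_⟩
    change centralSMul (σ z) _ = _
    rw [← hσ, ← hz, Functor.map_preimage]

theorem restrictScalars_full_of_surjective (f : R →+* S) (hf : Function.Surjective f) :
    (restrictScalars.{u} f).Full where
  map_surjective {M N} φ := ⟨ofHom
    { toFun := fun m => φ.hom m
      map_add' := fun m m' => φ.hom.map_add m m'
      map_smul' := fun s m => by
        obtain ⟨r, rfl⟩ := hf s
        exact φ.hom.map_smul r m }, rfl⟩

theorem mem_essImage_restrictScalars (f : R →+* S) (hf : Function.Surjective f)
    (M : ModuleCat.{u} R) (hM : ∀ r, f r = 0 → ∀ m : M, r • m = 0) :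
    (restrictScalars.{u} f).essImage M := by
  let inst : SMul S M := ⟨fun s m => Function.surjInv hf s • m⟩
  have hsmul : ∀ (r : R) (m : M), f r • m = r • m := fun r m => by
    rw [← sub_eq_zero]
    change Function.surjInv hf (f r) • m - r • m = 0
    rw [← sub_smul]
    exact hM _ (by rw [map_sub, Function.surjInv_eq hf, sub_self]) m
  let inst' : Module S M := hf.moduleLeft f hsmul
  let N : ModuleCat.{u} R := (restrictScalars f).obj (of S M)
  let e : N ≃ₗ[R] M := { AddEquiv.refl M with map_smul' := hsmul }
  exact ⟨of S M, ⟨e.toModuleIso⟩⟩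

theorem essImage_restrictScalars_iff {ι : Type*} [Fintype ι] (f : R →+* S)
    (hf : Function.Surjective f) (x : ι → Subring.center R) (hx : ∀ i, f (x i) = 0)
    (hker : ∀ r, f r = 0 → ∃ a : ι → R, r = ∑ i, a i * x i) (M : ModuleCat.{u} R) :
    (restrictScalars.{u} f).essImage M ↔ ∀ i, centralSMul (x i) M = 0 := by
  constructor
  · rintro ⟨N, ⟨e⟩⟩ i
    have h0 : centralSMul (x i) ((restrictScalars.{u} f).obj N) = 0 := by
      ext n
      have h1 : f (x i) • (show N from n) = 0 := by rw [hx, zero_smul]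
      exact h1
    rw [← cancel_epi e.hom, ← centralSMul_naturality, h0, Limits.zero_comp, Limits.comp_zero]
  · intro h
    refine mem_essImage_restrictScalars f hf M fun r hr m => ?_
    obtain ⟨a, rfl⟩ := hker r hr
    rw [Finset.sum_smul]
    refine Finset.sum_eq_zero fun i _ => ?_
    have h1 : (x i : R) • m = 0 := CategoryTheory.congr_fun (h i) m
    rw [mul_smul, h1, smul_zero]

/-- An equivalence of module categories over `P` and `Q` restricts to an equivalence of module
categories over quotients of `P` and `Q` cut out by corresponding central elements. -/
theorem nonempty_equivalence_of_surjective {ι : Type*} [Fintype ι] {P Q A B : Type u} [Ring P]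
    [Ring Q] [Ring A] [Ring B]
    (E : ModuleCat.{u} P ≌ ModuleCat.{u} Q) (f : P →+* A) (hf : Function.Surjective f)
    (g : Q →+* B) (hg : Function.Surjective g) (x : ι → Subring.center P)
    (y : ι → Subring.center Q) (hfx : ∀ i, f (x i) = 0) (hgy : ∀ i, g (y i) = 0)
    (hker_f : ∀ p, f p = 0 → ∃ a : ι → P, p = ∑ i, a i * x i)
    (hker_g : ∀ q, g q = 0 → ∃ a : ι → Q, q = ∑ i, a i * y i)
    (hE : ∀ i M, E.functor.map (centralSMul (x i) M) = centralSMul (y i) (E.functor.obj M)) :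
    Nonempty (ModuleCat.{u} A ≌ ModuleCat.{u} B) := by
  have := restrictScalars_full_of_surjective f hf
  have := restrictScalars_full_of_surjective g hg
  have hiff : ∀ M, (restrictScalars.{u} f).essImage M ↔
      (restrictScalars.{u} g).essImage (E.functor.obj M) := by
    intro M
    rw [essImage_restrictScalars_iff f hf x hfx hker_f,
      essImage_restrictScalars_iff g hg y hgy hker_g]
    refine forall_congr' fun i => ?_
    rw [← hE, Functor.map_eq_zero_iff]
  let H : ModuleCat.{u} A ⥤ (restrictScalars.{u} g).EssImageSubcategory :=
    (restrictScalars.{u} g).essImage.lift (restrictScalars.{u} f ⋙ E.functor)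
      fun M => (hiff _).mp (Functor.obj_mem_essImage _ M)
  have : H.EssSurj := ⟨fun N => by
    have hN : (restrictScalars.{u} f).essImage (E.inverse.obj N.obj) :=
      (hiff _).mpr ((restrictScalars.{u} g).essImage.prop_of_iso
        (E.counitIso.app N.obj).symm N.property)
    obtain ⟨M, ⟨e⟩⟩ := hN
    exact ⟨M, ⟨ObjectProperty.isoMk _ (E.functor.mapIso e ≪≫ E.counitIso.app N.obj)⟩⟩⟩
  have : H.IsEquivalence := {}
  have : (restrictScalars.{u} g).toEssImage.IsEquivalence := {}
  exact ⟨H.asEquivalence.trans (restrictScalars.{u} g).toEssImage.asEquivalence.symm⟩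

end ModuleCat

theorem Ring.krullDimLE_zero_of_quotient_nilradical {R : Type*} [CommRing R]
    (h : Ring.KrullDimLE 0 (R ⧸ nilradical R)) : Ring.KrullDimLE 0 R := by
  rw [Ideal.krullDimLE_zero_quotient_iff_forall_minimalPrimes_isMaximal, nilradical,
    Ideal.radical_minimalPrimes] at h
  exact Ring.krullDimLE_zero_iff_forall_minimalPrimes_isMaximal.mpr h

theorem krullDimLE_zero_center {k A : Type*} [Field k] [Ring A] [Algebra k A]
    (hdim : ringKrullDim
      ((Subalgebra.center k A) ⧸ nilradical (Subalgebra.center k A)) = 0) :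
    Ring.KrullDimLE 0 (Subring.center A) := by
  have h := Ring.krullDimLE_zero_of_quotient_nilradical (Ring.krullDimLE_iff.mpr hdim.le)
  let e : Subalgebra.center k A ≃+* Subring.center A :=
    { toFun := fun z => ⟨z, z.2⟩
      invFun := fun z => ⟨z, z.2⟩
      left_inv := fun _ => rfl
      right_inv := fun _ => rfl
      map_mul' := fun _ _ => rfl
      map_add' := fun _ _ => rfl }
  rw [Ring.krullDimLE_iff, ← ringKrullDim_eq_of_ringEquiv e]
  exact Ring.krullDimLE_iff.mp h

theorem stronglyCancellative_of_krullDimLE_zero_center (k A : Type u) [Field k] [Ring A]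
    [Algebra k A] [Ring.KrullDimLE 0 (Subring.center A)] : StronglyCancellative k A := by
  rintro n - B _ _ ⟨φ⟩
  obtain ⟨Φ, hconst, hX⟩ :=
    PolyExt.exists_ringEquiv_of_center (Subring.centerCongr φ.toRingEquiv)
  let χ : PolyExt B n ≃+* PolyExt A n := Φ.trans φ.symm.toRingEquiv
  have hχ : ∀ i, χ (PolyExt.X B n i) = PolyExt.X A n i := fun i => by
    change φ.symm (Φ _) = _
    rw [hX]
    exact (φ.symm_apply_apply _).trans (PolyExt.ofCenter_X i)
  let ψ : B →+* A := ((PolyExt.evalZero A n).comp χ.toRingHom).comp (PolyExt.const B n)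
  have hψ : ∀ c, ψ (algebraMap k B c) = algebraMap k A c := fun c => by
    have h1 : χ (PolyExt.const B n (algebraMap k B c)) = PolyExt.const A n (algebraMap k A c) := by
      change φ.symm (Φ _) = _
      rw [hconst]
      exact φ.symm.commutes c
    change PolyExt.evalZero A n (χ _) = _
    rw [h1, PolyExt.evalZero_const]
  exact ⟨(AlgEquiv.ofBijective { ψ with commutes' := hψ }
    (PolyExt.bijective_evalZero_comp_const χ hχ)).symm⟩

theorem stronglyMoritaCancellative_of_krullDimLE_zero_center (k A : Type u) [Field k] [Ring A]
    [Algebra k A] [Ring.KrullDimLE 0 (Subring.center A)] : StronglyMoritaCancellative k A := by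
  rintro n - B _ _ ⟨E⟩
  obtain ⟨σ, hσ⟩ := ModuleCat.exists_center_ringEquiv E
  let θ : Subring.center (PolyExt A n) ≃+* Subring.center (PolyExt B n) :=
    (Subring.centerToMulOpposite.trans σ).trans Subring.centerToMulOpposite.symm
  obtain ⟨Φ, hconst, hX⟩ := PolyExt.exists_ringEquiv_of_center θ
  let x : Fin n → Subring.center (PolyExt A n) :=
    fun i => PolyExt.centerEquiv A n (MvPolynomial.X i)
  have hx : ∀ i, (x i : PolyExt A n) = PolyExt.X A n i := fun i => PolyExt.ofCenter_X i
  have hθ : ∀ i, Φ.symm (θ (x i)) = PolyExt.X B n i := fun i => by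
    rw [← hX, Φ.symm_apply_apply]
  have hcomm : ∀ {R : Type u} [Ring R] (z : Subring.center R) (r : R), r * z = z * r :=
    fun z r => Subring.mem_center_iff.mp z.2 r
  refine ModuleCat.nonempty_equivalence_of_surjective E
    (PolyExt.evalZero A n).op
    (fun a => ⟨MulOpposite.op (PolyExt.const A n a.unop), by simp⟩)
    ((PolyExt.evalZero B n).comp Φ.symm.toRingHom).op
    (fun b => ⟨MulOpposite.op (Φ (PolyExt.const B n b.unop)), by simp⟩)
    (fun i => Subring.centerToMulOpposite (x i))
    (fun i => Subring.centerToMulOpposite (θ (x i))) (fun i => ?_) (fun i => ?_)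
    (fun p hp => ?_) (fun q hq => ?_) (fun i M => ?_)
  · exact congrArg MulOpposite.op
      ((congrArg (PolyExt.evalZero A n) (hx i)).trans (PolyExt.evalZero_X i))
  · exact congrArg MulOpposite.op
      ((congrArg (PolyExt.evalZero B n) (hθ i)).trans (PolyExt.evalZero_X i))
  · obtain ⟨a, ha⟩ := PolyExt.exists_eq_sum_of_evalZero_eq_zero (MulOpposite.op_injective hp)
    refine ⟨fun i => MulOpposite.op (a i), MulOpposite.unop_injective ?_⟩
    rw [ha, Finset.unop_sum]
    refine Finset.sum_congr rfl fun i _ => ?_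
    rw [← hx, hcomm]
    rfl
  · obtain ⟨a, ha⟩ := PolyExt.exists_eq_sum_of_evalZero_eq_zero (MulOpposite.op_injective hq)
    refine ⟨fun i => MulOpposite.op (Φ (a i)), MulOpposite.unop_injective ?_⟩
    have h1 : q.unop = ∑ i, Φ (a i) * θ (x i) := by
      have h2 := congrArg Φ ha
      rw [map_sum] at h2
      refine (Φ.apply_symm_apply _).symm.trans (h2.trans ?_)
      exact Finset.sum_congr rfl fun i _ => by rw [map_mul, hX]
    rw [h1, Finset.unop_sum]
    refine Finset.sum_congr rfl fun i _ => ?_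
    rw [hcomm]
    rfl
  · rw [hσ]
    simp [θ]

/-- If `Z/N(Z)` is von Neumann regular (reduced of Krull dimension
zero), then `A` is strongly cancellative and strongly Morita cancellative. -/
theorem strongly_cancellative_of_center_mod_nilradical_vonNeumann_regular
    (k A : Type u) [Field k] [Ring A] [Algebra k A]
    (hred : IsReduced ((Subalgebra.center k A) ⧸ nilradical (Subalgebra.center k A)))
    (hdim : ringKrullDim
      ((Subalgebra.center k A) ⧸ nilradical (Subalgebra.center k A)) = 0) :
    StronglyCancellative k A ∧ StronglyMoritaCancellative k A := by
  have := krullDimLE_zero_center hdim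
  exact ⟨stronglyCancellative_of_krullDimLE_zero_center k A,
    stronglyMoritaCancellative_of_krullDimLE_zero_center k A⟩
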